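/- (Tempering chain tracks the final target; quantitative form of Theorem B.1(ii).) Let (S,𝒮) be a measurable space and (K_s)_{s∈[0,1]} a family of Markov kernels on S such that: (i) there exist θ ∈ (0,1] and a probability measure ζ with K_s(x,·) ≥ θ ζ(·) for all s ∈ [0,1] and x ∈ S; (ii) there exists C < ∞ with sup_{x∈S} ‖K_s(x,·) − K_t(x,·)‖_TV ≤ C|s−t| for all s,t ∈ [0,1]. Let π_s denote the unique invariant probability measure of K_s. Then there exists C' < ∞, depending only on C and θ, such that for every d ∈ ℕ and every probability measure ν on S, the measure ν_d := ν K_{1/d} K_{2/d} ⋯ K_{d/d}, obtained by applying sequentially the d kernels at the equally spaced temperatures 1/d, 2/d, …, 1, satisfies ‖ν_d − π_1‖_TV ≤ C' ( (1−θ)^d + 1/d ). In particular ν_d converges to π_1 in total variation as d → ∞, uniformly in the initial distribution ν. -/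

import Mathlib

open MeasureTheory ProbabilityTheory

/-- Total variation distance `‖μ−ν‖_TV := sup_A |μ(A) − ν(A)|`, supremum over measurable sets. -/
noncomputable def tvDist {α : Type*} [MeasurableSpace α] (μ ν : Measure α) : ℝ :=
  ⨆ s : {s : Set α // MeasurableSet s}, |(μ s.1).toReal - (ν s.1).toReal|

/-- Each event's probability discrepancy is at most the total variation distance. -/
theorem abs_sub_le_tvDist {α : Type*} [MeasurableSpace α] (μ ν : Measure α)
    [IsProbabilityMeasure μ] [IsProbabilityMeasure ν] {A : Set α} (hA : MeasurableSet A) :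
    |μ.real A - ν.real A| ≤ tvDist μ ν := by
  refine le_ciSup (f := fun s : {s : Set α // MeasurableSet s} =>
    |(μ s.1).toReal - (ν s.1).toReal|) ⟨1, ?_⟩ ⟨A, hA⟩
  rintro _ ⟨s, rfl⟩
  exact abs_sub_le_of_nonneg_of_le measureReal_nonneg measureReal_le_one
    measureReal_nonneg measureReal_le_one

theorem tvDist_le {α : Type*} [MeasurableSpace α] {μ ν : Measure α} {c : ℝ}
    (h : ∀ A, MeasurableSet A → |μ.real A - ν.real A| ≤ c) : tvDist μ ν ≤ c :=
  haveI : Nonempty {s : Set α // MeasurableSet s} := ⟨⟨∅, MeasurableSet.empty⟩⟩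
  ciSup_le fun s => h s.1 s.2

theorem tvDist_le_one {α : Type*} [MeasurableSpace α] (μ ν : Measure α)
    [IsProbabilityMeasure μ] [IsProbabilityMeasure ν] : tvDist μ ν ≤ 1 :=
  tvDist_le fun _ _ => abs_sub_le_of_nonneg_of_le measureReal_nonneg measureReal_le_one
    measureReal_nonneg measureReal_le_one

theorem tvDist_triangle {α : Type*} [MeasurableSpace α] (μ ν ρ : Measure α)
    [IsProbabilityMeasure μ] [IsProbabilityMeasure ν] [IsProbabilityMeasure ρ] :
    tvDist μ ρ ≤ tvDist μ ν + tvDist ν ρ :=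
  tvDist_le fun _ hA => (abs_sub_le _ _ _).trans
    (add_le_add (abs_sub_le_tvDist μ ν hA) (abs_sub_le_tvDist ν ρ hA))

/-- Integrals of a function with values in `[0, M]` differ by at most `M` times the total
variation distance. -/
theorem abs_integral_sub_le_mul_tvDist_of_nonneg {α : Type*} [MeasurableSpace α]
    (μ ν : Measure α) [IsProbabilityMeasure μ] [IsProbabilityMeasure ν] {f : α → ℝ} {M : ℝ}
    (hM : 0 ≤ M) (hf : Measurable f) (h0 : ∀ x, 0 ≤ f x) (h1 : ∀ x, f x ≤ M) :
    |∫ x, f x ∂μ - ∫ x, f x ∂ν| ≤ M * tvDist μ ν := by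
  have hint (ρ : Measure α) [IsProbabilityMeasure ρ] : Integrable f ρ :=
    Integrable.of_bound hf.aestronglyMeasurable M
      (ae_of_all _ fun x => by rw [Real.norm_of_nonneg (h0 x)]; exact h1 x)
  have hlayer (ρ : Measure α) [IsProbabilityMeasure ρ] :
      ∫ x, f x ∂ρ = ∫ t in (0 : ℝ)..M, ρ.real {x | t ≤ f x} := by
    rw [intervalIntegral.integral_of_le hM]
    exact (hint ρ).integral_eq_integral_Ioc_meas_le (ae_of_all _ h0) (ae_of_all _ h1)
  have hanti (ρ : Measure α) [IsProbabilityMeasure ρ] :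
      IntervalIntegrable (fun t => ρ.real {x | t ≤ f x}) volume 0 M :=
    Antitone.intervalIntegrable fun s t hst =>
      measureReal_mono fun x (hx : t ≤ f x) => hst.trans hx
  rw [hlayer μ, hlayer ν, ← intervalIntegral.integral_sub (hanti μ) (hanti ν)]
  have := intervalIntegral.norm_integral_le_of_norm_le_const (a := 0) (b := M)
    (f := fun t => μ.real {x | t ≤ f x} - ν.real {x | t ≤ f x}) (C := tvDist μ ν)
    fun t _ => abs_sub_le_tvDist μ ν (measurableSet_le measurable_const hf)
  rwa [sub_zero, abs_of_nonneg hM, mul_comm, Real.norm_eq_abs] at this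

/-- Integrals of a function with values in `[a, b]` differ by at most `b - a` times the total
variation distance. -/
theorem abs_integral_sub_le_mul_tvDist {α : Type*} [MeasurableSpace α]
    (μ ν : Measure α) [IsProbabilityMeasure μ] [IsProbabilityMeasure ν] {f : α → ℝ} {a b : ℝ}
    (hab : a ≤ b) (hf : Measurable f) (ha : ∀ x, a ≤ f x) (hb : ∀ x, f x ≤ b) :
    |∫ x, f x ∂μ - ∫ x, f x ∂ν| ≤ (b - a) * tvDist μ ν := by
  have hint (ρ : Measure α) [IsProbabilityMeasure ρ] : Integrable f ρ :=
    Integrable.of_mem_Icc a b hf.aemeasurable (ae_of_all _ fun x => ⟨ha x, hb x⟩)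
  have h := abs_integral_sub_le_mul_tvDist_of_nonneg μ ν (f := fun x => f x - a)
    (sub_nonneg.2 hab) (hf.sub_const a) (fun x => sub_nonneg.2 (ha x))
    (fun x => sub_le_sub_right (hb x) a)
  rw [integral_sub (hint μ) (integrable_const a), integral_sub (hint ν) (integrable_const a)] at h
  simpa using h

theorem measurable_kernel_real {α β : Type*} [MeasurableSpace α] [MeasurableSpace β]
    (κ : Kernel α β) {A : Set β} (hA : MeasurableSet A) :
    Measurable fun x => (κ x).real A :=
  (κ.measurable_coe hA).ennreal_toReal

theorem bind_kernel_real_apply {α β : Type*} [MeasurableSpace α] [MeasurableSpace β]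
    (μ : Measure α) (κ : Kernel α β) [IsMarkovKernel κ] {A : Set β} (hA : MeasurableSet A) :
    (μ.bind κ).real A = ∫ x, (κ x).real A ∂μ := by
  rw [measureReal_def, Measure.bind_apply hA κ.measurable.aemeasurable]
  exact (integral_toReal (κ.measurable_coe hA).aemeasurable
    (ae_of_all _ fun x => measure_lt_top _ _)).symm

/-- A Doeblin minorization makes a Markov kernel a `(1 - θ)`-contraction in total variation. -/
theorem tvDist_bind_le_of_minorization {α β : Type*} [MeasurableSpace α] [MeasurableSpace β]
    (κ : Kernel α β) [IsMarkovKernel κ] (ζ : Measure β) [IsProbabilityMeasure ζ] {θ : ℝ}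
    (h0 : 0 ≤ θ) (h1 : θ ≤ 1)
    (hκ : ∀ x, ∀ A, MeasurableSet A → ENNReal.ofReal θ * ζ A ≤ κ x A)
    (μ ν : Measure α) [IsProbabilityMeasure μ] [IsProbabilityMeasure ν] :
    tvDist (μ.bind κ) (ν.bind κ) ≤ (1 - θ) * tvDist μ ν := by
  have hreal (x : α) {A : Set β} (hA : MeasurableSet A) : θ * ζ.real A ≤ (κ x).real A := by
    have := ENNReal.toReal_mono (measure_ne_top _ _) (hκ x A hA)
    rwa [ENNReal.toReal_mul, ENNReal.toReal_ofReal h0] at this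
  refine tvDist_le fun A hA => ?_
  rw [bind_kernel_real_apply μ κ hA, bind_kernel_real_apply ν κ hA]
  have h := abs_integral_sub_le_mul_tvDist μ ν (a := θ * ζ.real A)
    (b := 1 - θ * (1 - ζ.real A)) (by linarith) (measurable_kernel_real κ hA)
    (fun x => hreal x hA) (fun x => by
      have := hreal x hA.compl
      rw [probReal_compl_eq_one_sub hA, probReal_compl_eq_one_sub hA] at this
      linarith)
  convert h using 2
  ring

/-- Uniformly close kernels have close images of a common initial distribution. -/
theorem tvDist_bind_le_of_forall_le {α β : Type*} [MeasurableSpace α] [MeasurableSpace β]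
    (κ η : Kernel α β) [IsMarkovKernel κ] [IsMarkovKernel η] {c : ℝ}
    (h : ∀ x, tvDist (κ x) (η x) ≤ c) (μ : Measure α) [IsProbabilityMeasure μ] :
    tvDist (μ.bind κ) (μ.bind η) ≤ c := by
  have hint (ρ : Kernel α β) [IsMarkovKernel ρ] {A : Set β} (hA : MeasurableSet A) :
      Integrable (fun x => (ρ x).real A) μ :=
    Integrable.of_mem_Icc 0 1 (measurable_kernel_real ρ hA).aemeasurable
      (ae_of_all _ fun _ => ⟨measureReal_nonneg, measureReal_le_one⟩)
  refine tvDist_le fun A hA => ?_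
  rw [bind_kernel_real_apply μ κ hA, bind_kernel_real_apply μ η hA,
    ← integral_sub (hint κ hA) (hint η hA)]
  have := norm_integral_le_of_norm_le_const (μ := μ)
    (f := fun x => (κ x).real A - (η x).real A) (C := c)
    (ae_of_all _ fun x => (abs_sub_le_tvDist (κ x) (η x) hA).trans (h x))
  simpa using this

/-- Tempering chain tracks the final target; quantitative form of
Theorem B.1(ii). Under a common Doeblin minorization with constant `θ` and TV-Lipschitz
continuity in the temperature with constant `C`, there is `C' < ∞`, depending only on `C` and
`θ`, such that for every `d` and every initial probability measure `ν`, the measure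
`ν_d = ν K_{1/d} K_{2/d} ⋯ K_{d/d}` satisfies `‖ν_d − π_1‖_TV ≤ C'((1−θ)^d + 1/d)`. -/
theorem tempering_chain_tracks_target.{u} :
    ∀ (θ C : ℝ), 0 < θ → θ ≤ 1 → 0 ≤ C →
    ∃ C' : ℝ, 0 ≤ C' ∧
      ∀ (S : Type u) (_ : MeasurableSpace S) (K : ℝ → Kernel S S),
        (∀ s, IsMarkovKernel (K s)) →
        ∀ (ζ : Measure S), IsProbabilityMeasure ζ →
        (∀ s ∈ Set.Icc (0:ℝ) 1, ∀ x : S, ∀ A : Set S, MeasurableSet A →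
          ENNReal.ofReal θ * ζ A ≤ K s x A) →
        (∀ s ∈ Set.Icc (0:ℝ) 1, ∀ t ∈ Set.Icc (0:ℝ) 1, ∀ x : S,
          tvDist (K s x) (K t x) ≤ C * |s - t|) →
        ∀ (π1 : Measure S), IsProbabilityMeasure π1 → (π1.bind fun x => K 1 x) = π1 →
        ∀ (ν : Measure S), IsProbabilityMeasure ν →
        ∀ (d : ℕ), 0 < d →
        ∀ (νs : ℕ → Measure S), νs 0 = ν →
          (∀ k < d, νs (k + 1) = (νs k).bind fun x => K (((k : ℝ) + 1) / (d : ℝ)) x) →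
          tvDist (νs d) π1 ≤ C' * ((1 - θ) ^ d + 1 / (d : ℝ)) := by
  intro θ C hθ hθ1 hC
  refine ⟨1 + C / θ ^ 2, by positivity, ?_⟩
  intro S _ K hK ζ _ hmin hlip π1 _ hπ ν hν d hd νs hν0 hstep
  have hd' : (0 : ℝ) < d := Nat.cast_pos.2 hd
  have key : ∀ k ≤ d, IsProbabilityMeasure (νs k) ∧
      tvDist (νs k) π1 ≤ (1 - θ) ^ k + C / (d * θ ^ 2) * ((d - k) * θ + 1) := by
    intro k
    induction k with
    | zero =>
      intro _
      rw [hν0]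
      refine ⟨hν, (tvDist_le_one ν π1).trans ?_⟩
      rw [pow_zero, Nat.cast_zero, sub_zero]
      exact le_add_of_nonneg_right (by positivity)
    | succ k ih =>
      intro hk
      obtain ⟨_, hle⟩ := ih (Nat.le_of_succ_le hk)
      have hkd : (k : ℝ) + 1 ≤ d := by exact_mod_cast hk
      set s : ℝ := ((k : ℝ) + 1) / d with hs
      have hs0 : 0 ≤ s := by positivity
      have hs1 : s ≤ 1 := (div_le_one hd').2 hkd
      have hbind : νs (k + 1) = (νs k).bind (K s) := hstep k hk
      have hπ' : π1.bind (K 1) = π1 := hπ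
      have hprob (ρ : Measure S) [IsProbabilityMeasure ρ] :
          IsProbabilityMeasure (ρ.bind (K s)) := inferInstance
      rw [hbind]
      refine ⟨hprob _, ?_⟩
      have hcontr := tvDist_bind_le_of_minorization (K s) ζ hθ.le hθ1
        (hmin s ⟨hs0, hs1⟩) (νs k) π1
      have hdrift : tvDist (π1.bind (K s)) π1 ≤ C * (1 - s) := by
        have := tvDist_bind_le_of_forall_le (K s) (K 1)
          (hlip s ⟨hs0, hs1⟩ 1 ⟨zero_le_one, le_rfl⟩) π1
        rwa [hπ', abs_sub_comm, abs_of_nonneg (sub_nonneg.2 hs1)] at this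
      have hrec : (1 - θ) * (C / (d * θ ^ 2) * ((d - k) * θ + 1)) + C * (1 - s) =
          C / (d * θ ^ 2) * ((d - (k + 1)) * θ + 1) - C / d := by
        rw [hs]
        field_simp
        ring
      have hCd : 0 ≤ C / d := by positivity
      have hmul := mul_le_mul_of_nonneg_left hle (sub_nonneg.2 hθ1)
      have htri := tvDist_triangle ((νs k).bind (K s)) (π1.bind (K s)) π1
      rw [pow_succ', Nat.cast_succ]
      linarith
  have hfinal := (key d le_rfl).2
  have hpow : 0 ≤ (1 - θ) ^ d := pow_nonneg (sub_nonneg.2 hθ1) d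
  have hsplit : (1 + C / θ ^ 2) * ((1 - θ) ^ d + 1 / d) =
      (1 - θ) ^ d + C / (d * θ ^ 2) + C / θ ^ 2 * (1 - θ) ^ d + 1 / d := by
    field_simp
    ring
  have hextra : 0 ≤ C / θ ^ 2 * (1 - θ) ^ d := by positivity
  have hinv : 0 ≤ 1 / (d : ℝ) := by positivity
  rw [sub_self, zero_mul, zero_add, mul_one] at hfinal
  linarith
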